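/- arXiv:2009.09652 — 4 statements merged into one kernel-verified Lean document; each statement's English description precedes it below -/
import Mathlib

section
/- Let n ≥ 3 be an integer and s₀ > 0 a real number. Suppose h : ℝⁿ → ℝ is continuous on the closed exterior region {y : ‖y‖ ≥ s₀}, harmonic on the open exterior region {y : ‖y‖ > s₀}, satisfies h(y) ≤ 0 for every y with ‖y‖ = s₀, and h(y) → 0 as ‖y‖ → ∞. Then h(y) ≤ 0 for every y with ‖y‖ ≥ s₀. -/
/-- A function on Euclidean space is harmonic on a set `U` if it is `C²` on `U`
and the sum of its second directional derivatives along the standard orthonormal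
basis vanishes at every point of `U`. -/
def HarmonicOnEuclidean {n : ℕ} (f : EuclideanSpace ℝ (Fin n) → ℝ)
    (U : Set (EuclideanSpace ℝ (Fin n))) : Prop :=
  ContDiffOn ℝ 2 f U ∧
    ∀ y ∈ U,
      ∑ i : Fin n,
        fderiv ℝ (fun x => fderiv ℝ f x (EuclideanSpace.single i (1 : ℝ))) y
          (EuclideanSpace.single i (1 : ℝ)) = 0

theorem second_deriv_aux {n : ℕ} (h : EuclideanSpace ℝ (Fin n) → ℝ)
    (U : Set (EuclideanSpace ℝ (Fin n))) (hU : IsOpen U) (hC : ContDiffOn ℝ 2 h U)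
    (z e : EuclideanSpace ℝ (Fin n)) (hz : z ∈ U) (he : ‖e‖ = 1) (ε : ℝ) (hε : 0 < ε)
    (hmax : IsLocalMax (fun y => h y + ε * ‖y‖ ^ 2) z) :
    fderiv ℝ (fun x => fderiv ℝ h x e) z e < 0 := by
  by_contra! hneg
  set D := fderiv ℝ (fun x => fderiv ℝ h x e) z e with hD
  have hline : ∀ t : ℝ, HasDerivAt (fun t : ℝ => z + t • e) e t := fun t => by
    simpa using ((hasDerivAt_id t).smul_const e).const_add z
  have hlc : Continuous (fun t : ℝ => z + t • e) := by fun_prop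
  set φ : ℝ → ℝ := fun t => h (z + t • e) + ε * ‖z + t • e‖ ^ 2 with hφ
  have hmaxφ : IsLocalMax φ 0 := by
    have : Filter.Tendsto (fun t : ℝ => z + t • e) (nhds 0) (nhds z) := by
      simpa using hlc.tendsto 0
    have := this.eventually hmax
    filter_upwards [this] with t ht
    simpa [hφ] using ht
  have hev : ∀ᶠ t : ℝ in nhds 0, z + t • e ∈ U :=
    hlc.continuousAt.eventually_mem (hU.mem_nhds (by simpa using hz))
  have hq : ∀ t : ℝ, ε * ‖z + t • e‖ ^ 2 = ε * (‖z‖ ^ 2 + 2 * t * inner ℝ z e + t ^ 2) := by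
    intro t
    rw [norm_add_sq_real, norm_smul, he, inner_smul_right]
    simp
    ring_nf
    simp
  have hd : ∀ x ∈ U, DifferentiableAt ℝ h x := fun x hx =>
    (hC.contDiffAt (hU.mem_nhds hx)).differentiableAt (by norm_num)
  have hdq : ∀ t : ℝ, HasDerivAt (fun t : ℝ => ε * ‖z + t • e‖ ^ 2)
      (ε * (2 * inner ℝ z e + 2 * t)) t := by
    intro t
    rw [funext hq]
    have h1 : HasDerivAt (fun t : ℝ => ‖z‖ ^ 2 + 2 * t * inner ℝ z e + t ^ 2)
        (2 * 1 * inner ℝ z e + 2 * t) t := by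
      refine HasDerivAt.add ?_ (by simpa using hasDerivAt_pow 2 t)
      exact (((hasDerivAt_id t).const_mul 2).mul_const _).const_add _
    simpa using h1.const_mul ε
  have hφ' : deriv φ =ᶠ[nhds 0]
      fun t => fderiv ℝ h (z + t • e) e + ε * (2 * inner ℝ z e + 2 * t) := by
    filter_upwards [hev] with t ht
    exact (((hd _ ht).hasFDerivAt.comp_hasDerivAt t (hline t)).add (hdq t)).deriv
  have hdd : DifferentiableAt ℝ (fun x => fderiv ℝ h x e) z := by
    have h1 : ContDiffAt ℝ 1 (fderiv ℝ h) z :=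
      (hC.contDiffAt (hU.mem_nhds hz)).fderiv_right (by norm_num)
    exact (h1.differentiableAt (by norm_num)).clm_apply (differentiableAt_const e)
  have hφ'' : deriv (deriv φ) 0 = D + 2 * ε := by
    rw [hφ'.deriv_eq]
    have h1 : HasDerivAt (fun t : ℝ => fderiv ℝ h (z + t • e) e) D 0 := by
      have h2 : HasFDerivAt (fun x => fderiv ℝ h x e)
        (fderiv ℝ (fun x => fderiv ℝ h x e) z) (z + (0 : ℝ) • e) := by
        simpa using hdd.hasFDerivAt
      exact h2.comp_hasDerivAt 0 (hline 0)
    have h3 : HasDerivAt (fun t : ℝ => ε * (2 * inner ℝ z e + 2 * t)) (ε * (2 * 1)) 0 :=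
      (((hasDerivAt_id (0 : ℝ)).const_mul 2).const_add _).const_mul ε
    refine (h1.add h3).deriv.trans ?_
    ring
  have hcφ : ContinuousAt φ 0 := by
    have h0 : z + (0 : ℝ) • e ∈ U := by simpa using hz
    exact (((hd _ h0).hasFDerivAt.comp_hasDerivAt 0 (hline 0)).add (hdq 0)).continuousAt
  have hmin : IsLocalMin φ 0 :=
    isLocalMin_of_deriv_deriv_pos (by rw [hφ'']; linarith) hmaxφ.deriv_eq_zero hcφ
  have hconst : φ =ᶠ[nhds 0] fun _ => φ 0 := by
    filter_upwards [hmaxφ, hmin] with t h1 h2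
    exact le_antisymm h1 h2
  have h4 := hconst.deriv.deriv_eq
  simp [hφ''] at h4
  linarith

/-- maximum principle for exterior regions: a function continuous on
`{‖y‖ ≥ s₀}`, harmonic on `{‖y‖ > s₀}`, nonpositive on `{‖y‖ = s₀}` and
tending to `0` as `‖y‖ → ∞` is nonpositive on `{‖y‖ ≥ s₀}`. -/
theorem exterior_maximum_principle (n : ℕ) (hn : 3 ≤ n) (s₀ : ℝ) (hs₀ : 0 < s₀)
    (h : EuclideanSpace ℝ (Fin n) → ℝ)
    (hcont : ContinuousOn h {y | s₀ ≤ ‖y‖})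
    (hharm : HarmonicOnEuclidean h {y | s₀ < ‖y‖})
    (hbdry : ∀ y : EuclideanSpace ℝ (Fin n), ‖y‖ = s₀ → h y ≤ 0)
    (hinf : Filter.Tendsto h
      (Filter.comap (fun y : EuclideanSpace ℝ (Fin n) => ‖y‖) Filter.atTop)
      (nhds 0)) :
    ∀ y : EuclideanSpace ℝ (Fin n), s₀ ≤ ‖y‖ → h y ≤ 0 := by
  intro y₀ hy₀
  by_contra! hM
  set M := h y₀ with hMdef
  obtain ⟨R₀, hR₀⟩ : ∃ R₀ : ℝ, ∀ y : EuclideanSpace ℝ (Fin n), R₀ ≤ ‖y‖ → h y < M / 2 := by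
    have h1 := hinf.eventually (gt_mem_nhds (half_pos hM))
    rw [Filter.eventually_comap] at h1
    obtain ⟨R, hR⟩ := Filter.eventually_atTop.1 h1
    exact ⟨R, fun y hy => hR _ hy y rfl⟩
  set R := max R₀ ‖y₀‖ with hR
  have hRpos : 0 < R := lt_of_lt_of_le (hs₀.trans_le hy₀) (le_max_right _ _)
  set ε := M / (4 * R ^ 2) with hε
  have hεpos : 0 < ε := by positivity
  have hεR : ε * R ^ 2 = M / 4 := by rw [hε]; field_simp
  set K : Set (EuclideanSpace ℝ (Fin n)) := {y | s₀ ≤ ‖y‖} ∩ Metric.closedBall 0 R with hK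
  have hKc : IsCompact K :=
    (isCompact_closedBall _ _).inter_left (isClosed_le continuous_const continuous_norm)
  have hgc : ContinuousOn (fun y => h y + ε * ‖y‖ ^ 2) K :=
    (hcont.mono Set.inter_subset_left).add (by fun_prop)
  obtain ⟨z, hzK, hzmax⟩ := hKc.exists_isMaxOn
    ⟨y₀, hy₀, by simp [hR]⟩ hgc
  have hz1 : s₀ ≤ ‖z‖ := hzK.1
  have hz2 : ‖z‖ ≤ R := by simpa using hzK.2
  have hge : M ≤ h z + ε * ‖z‖ ^ 2 := by
    have h1 : h y₀ + ε * ‖y₀‖ ^ 2 ≤ h z + ε * ‖z‖ ^ 2 :=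
      hzmax (show y₀ ∈ K from ⟨hy₀, by simp [hR]⟩)
    have : 0 ≤ ε * ‖y₀‖ ^ 2 := by positivity
    linarith
  have hle : ε * ‖z‖ ^ 2 ≤ M / 4 := by rw [← hεR]; gcongr
  have hz1' : s₀ < ‖z‖ := by
    refine lt_of_le_of_ne hz1 fun heq => ?_
    have := hbdry z heq.symm
    linarith
  have hz2' : ‖z‖ < R := by
    refine lt_of_le_of_ne hz2 fun heq => ?_
    have := hR₀ z (by rw [heq]; exact le_max_left _ _)
    linarith
  have hloc : IsLocalMax (fun y => h y + ε * ‖y‖ ^ 2) z := by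
    refine hzmax.isLocalMax ?_
    have h1 : ∀ᶠ y : EuclideanSpace ℝ (Fin n) in nhds z, s₀ < ‖y‖ :=
      continuous_norm.continuousAt.eventually (lt_mem_nhds hz1')
    have h2 : ∀ᶠ y : EuclideanSpace ℝ (Fin n) in nhds z, ‖y‖ < R :=
      continuous_norm.continuousAt.eventually (gt_mem_nhds hz2')
    filter_upwards [h1, h2] with y hy1 hy2
    exact ⟨hy1.le, by simpa using hy2.le⟩
  have hsum := hharm.2 z hz1'
  have hlt := Finset.sum_lt_sum_of_nonempty
    (s := (Finset.univ : Finset (Fin n))) ⟨⟨0, by omega⟩, Finset.mem_univ _⟩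
    (fun i _ => second_deriv_aux h _ (isOpen_lt continuous_const continuous_norm) hharm.1 z
      (EuclideanSpace.single i (1 : ℝ)) hz1' (by simp) ε hεpos hloc)
  rw [hsum] at hlt
  simp at hlt
end

section
/- Let n ≥ 3 be an integer, s₀ > 0 and b real numbers. Suppose Ψ : ℝⁿ → ℝ is continuous on the closed exterior region {y : ‖y‖ ≥ s₀}, harmonic on the open exterior region {y : ‖y‖ > s₀}, satisfies Ψ(y) = b for every y with ‖y‖ = s₀, and Ψ(y) → 1 as ‖y‖ → ∞. Then Ψ(y) = 1 + (b − 1)·(s₀/‖y‖)^(n−2) for every y with ‖y‖ ≥ s₀. -/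
open Filter Topology

/-- Second directional derivative. -/
noncomputable def dirD2 {n : ℕ} (f : EuclideanSpace ℝ (Fin n) → ℝ)
    (e z : EuclideanSpace ℝ (Fin n)) : ℝ :=
  fderiv ℝ (fun x => fderiv ℝ f x e) z e

lemma diff_fderiv_apply {n : ℕ} {f : EuclideanSpace ℝ (Fin n) → ℝ}
    {z : EuclideanSpace ℝ (Fin n)} (hf : ContDiffAt ℝ 2 f z) (e : EuclideanSpace ℝ (Fin n)) :
    DifferentiableAt ℝ (fun x => fderiv ℝ f x e) z := by
  have h : ContDiffAt ℝ 1 (fderiv ℝ f) z := hf.fderiv_right (by norm_num)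
  have h2 : DifferentiableAt ℝ (fderiv ℝ f) z := h.differentiableAt (by norm_num)
  exact h2.clm_apply (differentiableAt_const e)

lemma ev_diff {n : ℕ} {f : EuclideanSpace ℝ (Fin n) → ℝ}
    {z : EuclideanSpace ℝ (Fin n)} (hf : ContDiffAt ℝ 2 f z) :
    ∀ᶠ x in 𝓝 z, DifferentiableAt ℝ f x := by
  filter_upwards [hf.eventually (by simp)] with x hx
  exact hx.differentiableAt (by norm_num)

lemma dirD2_add_mul {n : ℕ} {f g : EuclideanSpace ℝ (Fin n) → ℝ}
    {z : EuclideanSpace ℝ (Fin n)} (hf : ContDiffAt ℝ 2 f z) (hg : ContDiffAt ℝ 2 g z)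
    (c : ℝ) (e : EuclideanSpace ℝ (Fin n)) :
    dirD2 (fun x => f x + c * g x) e z = dirD2 f e z + c * dirD2 g e z := by
  have h : (fun x => fderiv ℝ (fun x => f x + c * g x) x e)
      =ᶠ[𝓝 z] (fun x => fderiv ℝ f x e + c * fderiv ℝ g x e) := by
    filter_upwards [ev_diff hf, ev_diff hg] with x h1 h2
    have := (h1.hasFDerivAt.add (h2.hasFDerivAt.const_mul c)).fderiv
    have h3 : fderiv ℝ (fun x => f x + c * g x) x = fderiv ℝ f x + c • fderiv ℝ g x := this
    rw [h3]; simp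
  unfold dirD2
  rw [h.fderiv_eq]
  have := ((diff_fderiv_apply hf e).hasFDerivAt.add
    ((diff_fderiv_apply hg e).hasFDerivAt.const_mul c)).fderiv
  have h3 : fderiv ℝ (fun x => fderiv ℝ f x e + c * fderiv ℝ g x e) z
    = fderiv ℝ (fun x => fderiv ℝ f x e) z + c • fderiv ℝ (fun x => fderiv ℝ g x e) z := this
  rw [h3]; simp

lemma dirD2_nonpos_of_max {n : ℕ} {f : EuclideanSpace ℝ (Fin n) → ℝ}
    {z : EuclideanSpace ℝ (Fin n)} (hf : ContDiffAt ℝ 2 f z) (hm : IsLocalMax f z)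
    (e : EuclideanSpace ℝ (Fin n)) : dirD2 f e z ≤ 0 := by
  by_contra! hpos
  set l : ℝ → EuclideanSpace ℝ (Fin n) := fun t => z + t • e with hl
  have hl0 : l 0 = z := by simp [hl]
  have hld : ∀ t, HasDerivAt l e t := by
    intro t
    simpa [hl] using ((hasDerivAt_id t).smul_const e).const_add z
  have hlc : Tendsto l (𝓝 0) (𝓝 z) := by
    have := (hld 0).continuousAt.tendsto
    rwa [hl0] at this
  have hd : deriv (f ∘ l) =ᶠ[𝓝 0] fun t => fderiv ℝ f (l t) e := by
    filter_upwards [hlc.eventually (ev_diff hf)] with t ht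
    exact (ht.hasFDerivAt.comp_hasDerivAt t (hld t)).deriv
  have hdd : deriv (deriv (f ∘ l)) 0 = dirD2 f e z := by
    rw [hd.deriv_eq]
    have h1 := (diff_fderiv_apply hf e).hasFDerivAt
    rw [← hl0] at h1
    have := (h1.comp_hasDerivAt (0:ℝ) (hld 0)).deriv
    rw [hl0] at this
    exact this
  have hmax : IsLocalMax (f ∘ l) 0 := by
    have := hlc.eventually hm
    filter_upwards [this] with t ht
    simpa [hl0] using ht
  have hc : ContinuousAt (f ∘ l) 0 := by
    have h1 : ContinuousAt f (l 0) := by rw [hl0]; exact hf.continuousAt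
    exact h1.comp (hld 0).continuousAt
  have hmin : IsLocalMin (f ∘ l) 0 :=
    isLocalMin_of_deriv_deriv_pos (by rw [hdd]; exact hpos) hmax.deriv_eq_zero hc
  have hconst : (f ∘ l) =ᶠ[𝓝 0] fun _ => (f ∘ l) 0 := by
    filter_upwards [hmax, hmin] with t h1 h2
    exact le_antisymm h1 h2
  have : deriv (deriv (f ∘ l)) 0 = 0 := by
    rw [hconst.deriv.deriv_eq]; simp
  linarith

/-- Radial power. -/
noncomputable def radPow (n : ℕ) (a : ℝ) (y : EuclideanSpace ℝ (Fin n)) : ℝ := (‖y‖ ^ 2) ^ a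

lemma radPow_hasFDerivAt {n : ℕ} (a : ℝ) {y : EuclideanSpace ℝ (Fin n)} (hy : y ≠ 0) :
    HasFDerivAt (radPow n a) ((a * (‖y‖ ^ 2) ^ (a - 1)) • (2 • innerSL ℝ y)) y := by
  have h1 : HasFDerivAt (fun x : EuclideanSpace ℝ (Fin n) => ‖x‖ ^ 2) (2 • innerSL ℝ y) y :=
    (hasStrictFDerivAt_norm_sq y).hasFDerivAt
  have h2 : (‖y‖ ^ 2 : ℝ) ≠ 0 := by simpa using hy
  have := h1.rpow_const (p := a) (Or.inl h2)
  exact this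

lemma radPow_contDiffAt {n : ℕ} (a : ℝ) {y : EuclideanSpace ℝ (Fin n)} (hy : y ≠ 0) :
    ContDiffAt ℝ 2 (radPow n a) y := by
  have h2 : (‖y‖ ^ 2 : ℝ) ≠ 0 := by simpa using hy
  exact ((contDiff_norm_sq ℝ).contDiffAt).rpow_const_of_ne h2

lemma dirD2_radPow {n : ℕ} (a : ℝ) {y : EuclideanSpace ℝ (Fin n)} (hy : y ≠ 0) (i : Fin n) :
    dirD2 (radPow n a) (EuclideanSpace.single i (1 : ℝ)) y =
      2 * a * (‖y‖ ^ 2) ^ (a - 1) + 4 * a * (a - 1) * (‖y‖ ^ 2) ^ (a - 1 - 1) * (y i) ^ 2 := by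
  have hev : (fun x => fderiv ℝ (radPow n a) x (EuclideanSpace.single i (1 : ℝ)))
      =ᶠ[𝓝 y] fun x => (2 * a) * (radPow n (a - 1) x * x i) := by
    filter_upwards [isOpen_ne.mem_nhds hy] with x hx
    rw [(radPow_hasFDerivAt a hx).fderiv]
    simp [radPow, EuclideanSpace.inner_single_right]
    ring
  unfold dirD2
  rw [hev.fderiv_eq]
  have hp : HasFDerivAt (fun x : EuclideanSpace ℝ (Fin n) => x i)
      (EuclideanSpace.proj i : EuclideanSpace ℝ (Fin n) →L[ℝ] ℝ) y :=
    (EuclideanSpace.proj i : EuclideanSpace ℝ (Fin n) →L[ℝ] ℝ).hasFDerivAt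
  have := (((radPow_hasFDerivAt (a - 1) hy).mul hp).const_mul (2 * a)).fderiv
  have h3 : fderiv ℝ (fun x : EuclideanSpace ℝ (Fin n) => (2 * a) * (radPow n (a - 1) x * x i)) y
    = _ := this
  rw [h3]
  simp [radPow, EuclideanSpace.inner_single_right]
  ring

lemma lap_radPow {n : ℕ} (a : ℝ) {y : EuclideanSpace ℝ (Fin n)} (hy : y ≠ 0) :
    ∑ i : Fin n, dirD2 (radPow n a) (EuclideanSpace.single i (1 : ℝ)) y =
      2 * a * (n + 2 * a - 2) * (‖y‖ ^ 2) ^ (a - 1) := by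
  simp_rw [dirD2_radPow a hy]
  rw [Finset.sum_add_distrib, ← Finset.mul_sum Finset.univ (fun i => y i ^ 2), ← EuclideanSpace.real_norm_sq_eq]
  have h2 : (0:ℝ) < ‖y‖ ^ 2 := by positivity
  have : (‖y‖ ^ 2 : ℝ) ^ (a - 1) = (‖y‖ ^ 2) ^ (a - 1 - 1) * ‖y‖ ^ 2 := by
    rw [← Real.rpow_add_one h2.ne']; ring_nf
  rw [this]
  simp
  ring

lemma ext_open (n : ℕ) (s : ℝ) : IsOpen {y : EuclideanSpace ℝ (Fin n) | s < ‖y‖} :=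
  isOpen_lt continuous_const continuous_norm

lemma ne_zero_of_ext {n : ℕ} {s : ℝ} (hs : 0 < s) {y : EuclideanSpace ℝ (Fin n)}
    (hy : s ≤ ‖y‖) : y ≠ 0 := by
  rintro rfl; simp at hy; linarith

lemma HarmonicOnEuclidean.add_mul {n : ℕ} {f g : EuclideanSpace ℝ (Fin n) → ℝ}
    {U : Set (EuclideanSpace ℝ (Fin n))} (hU : IsOpen U) (hf : HarmonicOnEuclidean f U)
    (hg : HarmonicOnEuclidean g U) (c : ℝ) :
    HarmonicOnEuclidean (fun x => f x + c * g x) U := by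
  refine ⟨hf.1.add (contDiffOn_const.mul hg.1), fun y hy => ?_⟩
  have h := fun i : Fin n => dirD2_add_mul (hf.1.contDiffAt (hU.mem_nhds hy))
    (hg.1.contDiffAt (hU.mem_nhds hy)) c (EuclideanSpace.single i (1 : ℝ))
  have h1 := hf.2 y hy
  have h2 := hg.2 y hy
  unfold dirD2 at h
  simp_rw [h]
  rw [Finset.sum_add_distrib, ← Finset.mul_sum, h1, h2]; simp

lemma radPow_tendsto (n : ℕ) {a : ℝ} (ha : a < 0) :
    Tendsto (radPow n a) (comap (fun y : EuclideanSpace ℝ (Fin n) => ‖y‖) atTop) (𝓝 0) := by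
  have h1 : Tendsto (fun r : ℝ => (r ^ 2) ^ a) atTop (𝓝 0) := by
    have := (tendsto_rpow_neg_atTop (y := -a) (by linarith)).comp
      (tendsto_pow_atTop (α := ℝ) (n := 2) (by norm_num))
    simpa [Function.comp_def] using this
  exact h1.comp tendsto_comap

lemma max_principle {n : ℕ} (hn : 3 ≤ n) {s : ℝ} (hs : 0 < s)
    {w : EuclideanSpace ℝ (Fin n) → ℝ}
    (hcont : ContinuousOn w {y | s ≤ ‖y‖})
    (hharm : HarmonicOnEuclidean w {y | s < ‖y‖})
    (hbdry : ∀ y : EuclideanSpace ℝ (Fin n), ‖y‖ = s → w y = 0)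
    (hinf : Tendsto w (comap (fun y : EuclideanSpace ℝ (Fin n) => ‖y‖) atTop) (𝓝 0)) :
    ∀ y : EuclideanSpace ℝ (Fin n), s ≤ ‖y‖ → w y ≤ 0 := by
  intro y₀ hy₀
  by_contra! hpos
  have hn' : (3:ℝ) ≤ n := by exact_mod_cast hn
  set a : ℝ := -((n:ℝ) - 1) / 2 with ha
  have ha0 : a < 0 := by rw [ha]; linarith
  set K : ℝ := (s ^ 2) ^ a with hK
  have hK0 : 0 < K := by positivity
  set ε : ℝ := w y₀ / (2 * K) with hε
  have hε0 : 0 < ε := by positivity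
  have hεK : ε * K = w y₀ / 2 := by rw [hε]; field_simp
  set v : EuclideanSpace ℝ (Fin n) → ℝ := fun x => w x + ε * radPow n a x with hv
  have hvy : ε * K < v y₀ := by
    have : 0 ≤ radPow n a y₀ := by unfold radPow; positivity
    have := mul_nonneg hε0.le this
    simp only [hv]; linarith
  have hvinf : Tendsto v (comap (fun y : EuclideanSpace ℝ (Fin n) => ‖y‖) atTop) (𝓝 0) := by
    simpa using hinf.add ((radPow_tendsto n ha0).const_mul ε)
  have hev := hvinf.eventually (gt_mem_nhds (show (0:ℝ) < ε * K by positivity))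
  rw [eventually_comap] at hev
  obtain ⟨R, hR⟩ := eventually_atTop.1 hev
  have hfar : ∀ y : EuclideanSpace ℝ (Fin n), R ≤ ‖y‖ → v y < ε * K := fun y hy => hR _ hy y rfl
  have hy₀R : ‖y₀‖ < R := by
    by_contra! h
    exact absurd (hfar y₀ h) (by linarith)
  have hvc : ContinuousOn v {y | s ≤ ‖y‖} := by
    refine hcont.add (continuousOn_const.mul fun y hy => ?_)
    exact (radPow_contDiffAt a (ne_zero_of_ext hs hy)).continuousAt.continuousWithinAt
  have hcomp : IsCompact ({y : EuclideanSpace ℝ (Fin n) | s ≤ ‖y‖} ∩ Metric.closedBall 0 R) :=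
    (isCompact_closedBall _ _).inter_left (isClosed_le continuous_const continuous_norm)
  obtain ⟨z, ⟨hz1, hz2⟩, hzmax⟩ := hcomp.exists_isMaxOn
    ⟨y₀, hy₀, by simpa using hy₀R.le⟩ (hvc.mono Set.inter_subset_left)
  have hvz : ε * K < v z := lt_of_lt_of_le hvy (hzmax ⟨hy₀, by simpa using hy₀R.le⟩)
  have hzR : ‖z‖ < R := by
    by_contra! h
    exact absurd (hfar z h) (by linarith)
  have hzs : s < ‖z‖ := by
    refine lt_of_le_of_ne hz1 fun h => ?_
    have : v z = ε * K := by simp only [hv, radPow, hbdry z h.symm, ← h, hK]; ring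
    linarith
  have hloc : IsLocalMax v z := by
    have o1 := (ext_open n s).mem_nhds hzs
    have o2 : {y : EuclideanSpace ℝ (Fin n) | ‖y‖ < R} ∈ 𝓝 z :=
      (isOpen_lt continuous_norm continuous_const).mem_nhds hzR
    filter_upwards [o1, o2] with y h1 h2
    exact hzmax ⟨le_of_lt h1, by simpa using le_of_lt h2⟩
  have hz0 := ne_zero_of_ext hs hzs.le
  have hwz := hharm.1.contDiffAt ((ext_open n s).mem_nhds hzs)
  have hqz := radPow_contDiffAt a hz0
  have hvC : ContDiffAt ℝ 2 v z := hwz.add (contDiffAt_const.mul hqz)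
  have hle : ∑ i : Fin n, dirD2 v (EuclideanSpace.single i (1 : ℝ)) z ≤ 0 :=
    Finset.sum_nonpos fun i _ => dirD2_nonpos_of_max hvC hloc _
  have hw : ∑ i : Fin n, dirD2 w (EuclideanSpace.single i (1 : ℝ)) z = 0 := hharm.2 z hzs
  simp_rw [hv, dirD2_add_mul hwz hqz] at hle
  rw [Finset.sum_add_distrib, ← Finset.mul_sum, hw, lap_radPow a hz0] at hle
  have e1 : 2 * a * (n + 2 * a - 2) = (n:ℝ) - 1 := by rw [ha]; ring
  rw [e1] at hle
  have h5 : 0 < (‖z‖ ^ 2) ^ (a - 1) := by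
    have : 0 < ‖z‖ := by linarith
    positivity
  have : 0 < ε * (((n:ℝ) - 1) * (‖z‖ ^ 2) ^ (a - 1)) :=
    mul_pos hε0 (mul_pos (by linarith) h5)
  linarith

/-- uniqueness for the exterior Dirichlet problem: a function
continuous on `{‖y‖ ≥ s₀}`, harmonic on `{‖y‖ > s₀}`, equal to `b` on
`{‖y‖ = s₀}` and tending to `1` at infinity must be
`y ↦ 1 + (b - 1) (s₀/‖y‖)^(n-2)`. -/
theorem exterior_dirichlet_uniqueness (n : ℕ) (hn : 3 ≤ n) (s₀ b : ℝ) (hs₀ : 0 < s₀)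
    (Ψ : EuclideanSpace ℝ (Fin n) → ℝ)
    (hcont : ContinuousOn Ψ {y | s₀ ≤ ‖y‖})
    (hharm : HarmonicOnEuclidean Ψ {y | s₀ < ‖y‖})
    (hbdry : ∀ y : EuclideanSpace ℝ (Fin n), ‖y‖ = s₀ → Ψ y = b)
    (hinf : Filter.Tendsto Ψ
      (Filter.comap (fun y : EuclideanSpace ℝ (Fin n) => ‖y‖) Filter.atTop)
      (nhds 1)) :
    ∀ y : EuclideanSpace ℝ (Fin n), s₀ ≤ ‖y‖ →
      Ψ y = 1 + (b - 1) * (s₀ / ‖y‖) ^ (n - 2) := by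
  set a : ℝ := -((n:ℝ) - 2) / 2 with ha
  have hn' : (3:ℝ) ≤ n := by exact_mod_cast hn
  have ha0 : a < 0 := by rw [ha]; linarith
  have hform : ∀ y : EuclideanSpace ℝ (Fin n), s₀ ≤ ‖y‖ →
      s₀ ^ (n - 2) * radPow n a y = (s₀ / ‖y‖) ^ (n - 2) := by
    intro y hy
    have hy0 : 0 < ‖y‖ := by linarith
    have : radPow n a y = (‖y‖ ^ (n - 2))⁻¹ := by
      unfold radPow
      rw [← Real.rpow_natCast ‖y‖ 2, ← Real.rpow_mul hy0.le, ← Real.rpow_natCast,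
        ← Real.rpow_neg hy0.le]
      congr 1
      rw [Nat.cast_sub (by omega), ha]
      push_cast; ring
    rw [this, div_pow]; rfl
  have hconst : ∀ c : ℝ, HarmonicOnEuclidean (fun _ => c)
      {y : EuclideanSpace ℝ (Fin n) | s₀ < ‖y‖} := by
    intro c
    refine ⟨contDiffOn_const, fun y _ => by simp⟩
  have hq : HarmonicOnEuclidean (radPow n a) {y : EuclideanSpace ℝ (Fin n) | s₀ < ‖y‖} := by
    refine ⟨fun y hy => (radPow_contDiffAt a
      (ne_zero_of_ext hs₀ (le_of_lt hy))).contDiffWithinAt, fun y hy => ?_⟩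
    have := lap_radPow a (ne_zero_of_ext hs₀ (le_of_lt hy))
    have e1 : (n + 2 * a - 2) = 0 := by rw [ha]; ring
    rw [e1] at this
    simpa [dirD2] using this
  set c : ℝ := -((b - 1) * s₀ ^ (n - 2)) with hc
  set w : EuclideanSpace ℝ (Fin n) → ℝ := fun x => (Ψ x + (-1) * 1) + c * radPow n a x with hw
  have hO := ext_open n s₀
  have hwh : HarmonicOnEuclidean w {y | s₀ < ‖y‖} :=
    (hharm.add_mul hO (hconst 1) (-1)).add_mul hO hq c
  have hweq : ∀ y : EuclideanSpace ℝ (Fin n), s₀ ≤ ‖y‖ →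
      w y = Ψ y - (1 + (b - 1) * (s₀ / ‖y‖) ^ (n - 2)) := by
    intro y hy
    rw [← hform y hy]; simp only [hw, hc]; ring
  have hwc : ContinuousOn w {y | s₀ ≤ ‖y‖} := by
    refine (hcont.add continuousOn_const).add (continuousOn_const.mul fun y hy => ?_)
    exact (radPow_contDiffAt a (ne_zero_of_ext hs₀ hy)).continuousAt.continuousWithinAt
  have hwb : ∀ y : EuclideanSpace ℝ (Fin n), ‖y‖ = s₀ → w y = 0 := by
    intro y hy
    rw [hweq y hy.ge, hbdry y hy, hy, div_self hs₀.ne']; simp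
  have hwi : Tendsto w (comap (fun y : EuclideanSpace ℝ (Fin n) => ‖y‖) atTop) (𝓝 0) := by
    have := (hinf.add_const ((-1) * 1)).add ((radPow_tendsto n ha0).const_mul c)
    have e : (1:ℝ) + (-1) * 1 + c * 0 = 0 := by ring
    rw [e] at this
    exact this
  have hneg : HarmonicOnEuclidean (fun x => 0 + (-1) * w x) {y | s₀ < ‖y‖} :=
    (hconst 0).add_mul hO hwh (-1)
  intro y hy
  have h1 := max_principle hn hs₀ hwc hwh hwb hwi y hy
  have h2 := max_principle (w := fun x => 0 + (-1) * w x) hn hs₀ (continuousOn_const.add (continuousOn_const.mul hwc)) hneg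
    (fun y hy => by simp [hwb y hy]) (by simpa using hwi.neg) y hy
  have h3 := hweq y hy
  linarith
end

section
/- Let m > 0 be a real number and let y ∈ ℝ³ (EuclideanSpace ℝ (Fin 3)) with y ≠ 0. Define f : ℝ³ \ {0} → ℝ by f(y) = (1 − m/(2‖y‖))/(1 + m/(2‖y‖)). Then the Euclidean gradient of f satisfies ‖∇f(y)‖² = (1/(16·m²))·(1 − f(y)²)⁴·(1 + m/(2‖y‖))⁴. -/
/-- for the Schwarzschild lapse in isotropic coordinates
`f(y) = (1 - m/(2‖y‖))/(1 + m/(2‖y‖))` on `ℝ³ \ {0}`, the Euclidean gradient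
satisfies `‖∇f(y)‖² = (1/(16m²)) (1 - f(y)²)⁴ (1 + m/(2‖y‖))⁴`. -/
theorem schwarzschild_W_constant (m : ℝ) (hm : 0 < m)
    (y : EuclideanSpace ℝ (Fin 3)) (hy : y ≠ 0)
    (f : EuclideanSpace ℝ (Fin 3) → ℝ)
    (hf : f = fun y : EuclideanSpace ℝ (Fin 3) =>
      (1 - m / (2 * ‖y‖)) / (1 + m / (2 * ‖y‖))) :
    ‖gradient f y‖ ^ 2
      = (1 / (16 * m ^ 2)) * (1 - (f y) ^ 2) ^ 4 * (1 + m / (2 * ‖y‖)) ^ 4 := by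
  have hs : 0 < ‖y‖ := norm_pos_iff.mpr hy
  have hd : DifferentiableAt ℝ (fun z : EuclideanSpace ℝ (Fin 3) => ‖z‖) y :=
    (contDiffAt_norm ℝ hy (n := 1)).differentiableAt (by norm_num)
  have hg : HasDerivAt (fun s : ℝ => (1 - m / (2 * s)) / (1 + m / (2 * s)))
      (4 * m / (2 * ‖y‖ + m) ^ 2) ‖y‖ := by
    have h2 : HasDerivAt (fun s : ℝ => m / (2 * s)) (-(m * 2) / (2 * ‖y‖) ^ 2) ‖y‖ := by
      have h1 : HasDerivAt (fun s : ℝ => 2 * s) 2 ‖y‖ := by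
        simpa using (hasDerivAt_id ‖y‖).const_mul (2 : ℝ)
      simpa using (hasDerivAt_const ‖y‖ m).fun_div h1 (by positivity)
    have h3 := (h2.const_sub 1).fun_div (h2.const_add 1) (by positivity)
    refine h3.congr_deriv ?_
    field_simp
    ring
  have hfd : HasFDerivAt f
      ((4 * m / (2 * ‖y‖ + m) ^ 2) •
        fderiv ℝ (fun z : EuclideanSpace ℝ (Fin 3) => ‖z‖) y) y := by
    rw [hf]
    exact hg.comp_hasFDerivAt y hd.hasFDerivAt
  have hn : ‖gradient f y‖ = 4 * m / (2 * ‖y‖ + m) ^ 2 := by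
    unfold gradient
    rw [LinearIsometryEquiv.norm_map, hfd.fderiv, norm_smul, norm_fderiv_norm hd, mul_one,
      Real.norm_of_nonneg (by positivity)]
  have hfy : 1 - f y ^ 2 = 8 * ‖y‖ * m / (2 * ‖y‖ + m) ^ 2 := by
    rw [hf]
    field_simp
    ring
  rw [hn, hfy]
  field_simp
  ring
end

section
/- Let c, H, N₀, A, m, S, χ be real numbers with c > 1, H > 0, N₀ > 0, N₀² ≤ 1/c, A > 0 and χ ≤ 2, and suppose that (i) 4·π·m = ¼·(c − 1)·H·N₀·A, (ii) S = ½·c·H², (iii) S·A = 4·π·χ, and (iv) 16·m²·(¼·(c − 1)·H·N₀)² ≥ (1 − N₀²)⁴. Then χ = 2, N₀² = 1/c, and 16·π·m² = (1 − 1/c)²·A. -/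
open Real

/-- the quantitative core of the photon surface uniqueness proof:
from `4πm = ¼(c-1)HN₀A`, `S = ½cH²`, `SA = 4πχ`,
`16m²(¼(c-1)HN₀)² ≥ (1-N₀²)⁴`, with `c > 1`, `H > 0`, `N₀ > 0`, `N₀² ≤ 1/c`,
`A > 0` and `χ ≤ 2`, one gets `χ = 2`, `N₀² = 1/c` and `16πm² = (1-1/c)²A`. -/
theorem photon_surface_uniqueness_arithmetic (c H N₀ A m S χ : ℝ)
    (hc : 1 < c) (hH : 0 < H) (hN₀ : 0 < N₀) (hN₀c : N₀ ^ 2 ≤ 1 / c)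
    (hA : 0 < A) (hχ : χ ≤ 2)
    (h1 : 4 * π * m = (1 / 4) * (c - 1) * H * N₀ * A)
    (h2 : S = (1 / 2) * c * H ^ 2)
    (h3 : S * A = 4 * π * χ)
    (h4 : 16 * m ^ 2 * ((1 / 4) * (c - 1) * H * N₀) ^ 2 ≥ (1 - N₀ ^ 2) ^ 4) :
    χ = 2 ∧ N₀ ^ 2 = 1 / c ∧ 16 * π * m ^ 2 = (1 - 1 / c) ^ 2 * A := by
  have hπ := Real.pi_pos
  have hc0 : 0 < c := by linarith
  have hc1 : 0 < c - 1 := by linarith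
  have hχ0 : 0 < χ := by
    have : 0 < 4 * π * χ := by rw [← h3, h2]; positivity
    exact pos_of_mul_pos_right this (by positivity)
  subst h2
  obtain ⟨k, hk⟩ : ∃ k, k = (1 / 4) * (c - 1) * H * N₀ := ⟨_, rfl⟩
  rw [← hk] at h1 h4
  have hE : 2 * c * (4 * m * k) = (c - 1) ^ 2 * N₀ ^ 2 * χ := by
    have h : 4 * π * (2 * c * (4 * m * k)) = 4 * π * ((c - 1) ^ 2 * N₀ ^ 2 * χ) := by
      rw [← sub_eq_zero]
      have e : 4 * π * (2 * c * (4 * m * k)) = 8 * c * k * (k * A) := by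
        linear_combination 8 * c * k * h1
      rw [e, hk]
      linear_combination (c - 1) ^ 2 * N₀ ^ 2 * h3
    exact mul_left_cancel₀ (by positivity) h
  have hE0 : 0 ≤ 4 * m * k := by
    have : 0 < 2 * c * (4 * m * k) := by rw [hE]; positivity
    exact (pos_of_mul_pos_right this (by positivity)).le
  have hge : (1 - N₀ ^ 2) ^ 2 ≤ 4 * m * k := by
    refine abs_le_of_sq_le_sq' ?_ hE0 |>.2
    nlinarith [h4]
  have hx : 0 < N₀ ^ 2 := by positivity
  obtain ⟨x, hxd⟩ : ∃ x, x = N₀ ^ 2 := ⟨_, rfl⟩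
  rw [← hxd] at hN₀c hE hge hx ⊢
  have hcx : c * x ≤ 1 := by
    rw [le_div_iff₀ hc0] at hN₀c; linarith
  have hxc : x < c := by nlinarith
  have hp : 0 < (c - 1) ^ 2 * x := by positivity
  have hb : (c - 1) ^ 2 * x * χ ≤ (c - 1) ^ 2 * x * 2 := by gcongr
  have hm : 2 * c * (1 - x) ^ 2 ≤ (c - 1) ^ 2 * x * χ := by rw [← hE]; gcongr
  have hcx' : c * x = 1 := by
    by_contra hne
    have hlt : c * x < 1 := lt_of_le_of_ne hcx hne
    nlinarith [mul_pos (sub_pos.2 hlt) (sub_pos.2 hxc)]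
  have hχ2 : χ = 2 := by
    apply le_antisymm hχ
    have h5 : 2 * c * (1 - x) ^ 2 = (c - 1) ^ 2 * x * 2 := by
      linear_combination 2 * (x - c) * hcx'
    rw [h5] at hm
    exact le_of_mul_le_mul_left hm hp
  have hxe : x = 1 / c := by field_simp; linarith
  refine ⟨hχ2, hxe, ?_⟩
  rw [hχ2] at hE
  have h6 : 4 * m * k = (1 - 1 / c) ^ 2 := by
    rw [hxe] at hE
    field_simp at hE ⊢
    linarith
  rw [← h6]
  linear_combination 4 * m * h1
end
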